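/- Let μ and ν be finite Borel measures on ℝ, each supported in (0, ∞), such that λ ↦ log λ is integrable with respect to both μ and ν. If for every t > 0 one has ∫ f(λ, t) dμ(λ) ≤ ∫ f(λ, t) dν(λ), then ∫ log λ dμ(λ) ≤ ∫ log λ dν(λ). -/

import Mathlib

open MeasureTheory

/-- `f(λ, t) = −((t+1)⁻¹ − λ(t+λ)⁻¹)/t = (λ−1)/((t+1)(t+λ))`. -/
noncomputable def f (lam t : ℝ) : ℝ := (lam - 1) / ((t + 1) * (t + lam))

open Set Filter Topology

/-- The function `t ↦ log (t + 1) - log (t + lam)` is a primitive of `f lam`. -/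
lemma hasDerivAt_log_sub_log {lam t : ℝ} (hlam : 0 < lam) (ht : 0 ≤ t) :
    HasDerivAt (fun s : ℝ => Real.log (s + 1) - Real.log (s + lam)) (f lam t) t := by
  have h1 : t + 1 ≠ 0 := by positivity
  have h2 : t + lam ≠ 0 := by positivity
  convert! (((hasDerivAt_id t).add_const 1).log h1).sub
    (((hasDerivAt_id t).add_const lam).log h2) using 1
  simp only [f, id]
  field_simp
  ring

lemma tendsto_log_sub_log_atTop {lam : ℝ} (hlam : 0 < lam) :
    Tendsto (fun s : ℝ => Real.log (s + 1) - Real.log (s + lam)) atTop (𝓝 0) := by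
  have hinv : Tendsto (fun s : ℝ => (1 - lam) / (s + lam)) atTop (𝓝 0) :=
    tendsto_const_nhds.div_atTop (tendsto_atTop_add_const_right _ _ tendsto_id)
  have hlog : Tendsto (fun s : ℝ => Real.log (1 + (1 - lam) / (s + lam))) atTop (𝓝 0) := by
    simpa using (hinv.const_add 1).log (by simp)
  refine hlog.congr' ?_
  filter_upwards [eventually_ge_atTop 0] with s hs
  have h1 : s + 1 ≠ 0 := by positivity
  have h2 : s + lam ≠ 0 := by positivity
  rw [← Real.log_div h1 h2]
  congr 1
  field_simp
  ring

lemma f_nonneg {lam t : ℝ} (hlam : 1 ≤ lam) (ht : 0 ≤ t) : 0 ≤ f lam t :=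
  div_nonneg (by linarith) (by positivity)

lemma f_nonpos {lam t : ℝ} (hpos : 0 < lam) (hlam : lam ≤ 1) (ht : 0 ≤ t) : f lam t ≤ 0 :=
  div_nonpos_of_nonpos_of_nonneg (by linarith) (by positivity)

lemma integrableOn_f {lam : ℝ} (hlam : 0 < lam) : IntegrableOn (f lam) (Ioi 0) := by
  rcases le_total 1 lam with h | h
  · exact integrableOn_Ioi_deriv_of_nonneg' (fun t ht => hasDerivAt_log_sub_log hlam ht)
      (fun t ht => f_nonneg h (le_of_lt ht)) (tendsto_log_sub_log_atTop hlam)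
  · exact integrableOn_Ioi_deriv_of_nonpos' (fun t ht => hasDerivAt_log_sub_log hlam ht)
      (fun t ht => f_nonpos hlam h (le_of_lt ht)) (tendsto_log_sub_log_atTop hlam)

/-- The integral representation of the logarithm. -/
lemma integral_f {lam : ℝ} (hlam : 0 < lam) : ∫ t in Ioi 0, f lam t = Real.log lam := by
  rw [integral_Ioi_of_hasDerivAt_of_tendsto' (fun t ht => hasDerivAt_log_sub_log hlam ht)
    (integrableOn_f hlam) (tendsto_log_sub_log_atTop hlam)]
  simp

lemma integral_norm_f {lam : ℝ} (hlam : 0 < lam) :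
    ∫ t in Ioi 0, ‖f lam t‖ = |Real.log lam| := by
  rcases le_total 1 lam with h | h
  · rw [abs_of_nonneg (Real.log_nonneg h), ← integral_f hlam]
    exact setIntegral_congr_fun measurableSet_Ioi
      fun t ht => Real.norm_of_nonneg (f_nonneg h (le_of_lt ht))
  · rw [abs_of_nonpos (Real.log_nonpos hlam.le h), ← integral_f hlam, ← integral_neg]
    exact setIntegral_congr_fun measurableSet_Ioi
      fun t ht => Real.norm_of_nonpos (f_nonpos hlam h (le_of_lt ht))

lemma measurable_uncurry_f : Measurable (Function.uncurry f) := by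
  unfold Function.uncurry f
  fun_prop

lemma ae_pos_of_measure_compl_Ioi {μ : Measure ℝ} (hμ : μ (Ioi (0 : ℝ))ᶜ = 0) :
    ∀ᵐ lam ∂μ, 0 < lam := hμ

lemma integrable_uncurry_f {μ : Measure ℝ} [IsFiniteMeasure μ] (hμ : ∀ᵐ lam ∂μ, 0 < lam)
    (hlog : Integrable (fun lam => Real.log lam) μ) :
    Integrable (Function.uncurry f) (μ.prod (volume.restrict (Ioi 0))) := by
  rw [integrable_prod_iff measurable_uncurry_f.aestronglyMeasurable]
  refine ⟨hμ.mono fun lam hlam => integrableOn_f hlam, hlog.abs.congr ?_⟩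
  exact hμ.mono fun lam hlam => (integral_norm_f hlam).symm

lemma integral_log_eq_integral_integral_f {μ : Measure ℝ} [IsFiniteMeasure μ]
    (hμ : ∀ᵐ lam ∂μ, 0 < lam) (hlog : Integrable (fun lam => Real.log lam) μ) :
    ∫ lam, Real.log lam ∂μ = ∫ t in Ioi 0, ∫ lam, f lam t ∂μ := by
  rw [← integral_integral_swap (integrable_uncurry_f hμ hlog)]
  exact integral_congr_ae (hμ.mono fun lam hlam => (integral_f hlam).symm)

/-- If `μ, ν` are finite Borel measures on `ℝ` supported in `(0, ∞)` with `log` integrable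
for both, and `∫ f(λ, t) dμ ≤ ∫ f(λ, t) dν` for every `t > 0`, then
`∫ log λ dμ ≤ ∫ log λ dν`. -/
theorem integral_log_le_integral_log (μ ν : Measure ℝ) [IsFiniteMeasure μ] [IsFiniteMeasure ν]
    (hμ : μ (Set.Ioi (0 : ℝ))ᶜ = 0) (hν : ν (Set.Ioi (0 : ℝ))ᶜ = 0)
    (hlogμ : Integrable (fun lam => Real.log lam) μ)
    (hlogν : Integrable (fun lam => Real.log lam) ν)
    (h : ∀ t : ℝ, 0 < t → (∫ lam, f lam t ∂μ) ≤ ∫ lam, f lam t ∂ν) :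
    (∫ lam, Real.log lam ∂μ) ≤ ∫ lam, Real.log lam ∂ν := by
  have hμ_pos := ae_pos_of_measure_compl_Ioi hμ
  have hν_pos := ae_pos_of_measure_compl_Ioi hν
  rw [integral_log_eq_integral_integral_f hμ_pos hlogμ,
    integral_log_eq_integral_integral_f hν_pos hlogν]
  exact setIntegral_mono_on (integrable_uncurry_f hμ_pos hlogμ).integral_prod_right
    (integrable_uncurry_f hν_pos hlogν).integral_prod_right measurableSet_Ioi fun t ht => h t ht
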